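/- arXiv:2404.16431 — 2 statements merged into one kernel-verified Lean document; each statement's English description precedes it below -/
import Mathlib

section
/- Let 𝔽 be a field, n a positive integer, and D the n×n Cauchy matrix associated with elements x_1,…,x_n, y_1,…,y_n ∈ 𝔽 (x_i pairwise distinct, y_j pairwise distinct, x_i + y_j ≠ 0 for all i, j). Then every J×m submatrix of D with J ≤ m has rank J (full row rank): the linear map 𝔽^m → 𝔽^J it induces is surjective. -/
/-- The rows of a Cauchy matrix with at least as many columns as rows are linearly independent. -/
theorem linearIndependent_row_of_cauchy {𝔽 ι κ : Type*} [Field 𝔽] [Fintype ι] [Fintype κ]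
    (hcard : Fintype.card ι ≤ Fintype.card κ) {x : ι → 𝔽} {y : κ → 𝔽}
    (hx : Function.Injective x) (hy : Function.Injective y) (hxy : ∀ i j, x i + y j ≠ 0)
    (A : Matrix ι κ 𝔽) (hA : ∀ i j, A i j = (x i + y j)⁻¹) :
    LinearIndependent 𝔽 A.row := by
  classical
  rw [Fintype.linearIndependent_iff]
  intro c hc
  let v : ι → 𝔽 := fun i => -x i
  let P : Polynomial 𝔽 :=
    ∑ i, Polynomial.C (c i) * Lagrange.nodal (Finset.univ.erase i) v
  have hdeg : P.degree < (Finset.univ : Finset κ).card := by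
    refine (Polynomial.degree_sum_le _ _).trans_lt ?_
    refine (Finset.sup_lt_iff (WithBot.bot_lt_coe _)).2 fun i _ => ?_
    rw [← Polynomial.smul_eq_C_mul]
    refine (Polynomial.degree_smul_le _ _).trans_lt ?_
    rw [Lagrange.degree_nodal, Nat.cast_lt]
    exact (Finset.card_erase_lt_of_mem (Finset.mem_univ i)).trans_le hcard
  have heval : ∀ j ∈ (Finset.univ : Finset κ), P.eval (y j) = 0 := by
    intro j _
    have hj : ∑ i, c i * (x i + y j)⁻¹ = 0 := by
      simpa [Matrix.row, hA] using congrFun hc j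
    calc P.eval (y j)
        = (∏ i, (x i + y j)) * ∑ i, c i * (x i + y j)⁻¹ := by
          simp only [P, v, Polynomial.eval_finsetSum, Polynomial.eval_mul, Polynomial.eval_C,
            Lagrange.eval_nodal, Finset.mul_sum, sub_neg_eq_add, add_comm (y j)]
          refine Finset.sum_congr rfl fun i hi => ?_
          rw [← Finset.mul_prod_erase _ _ hi]
          field_simp [hxy i j]
      _ = 0 := by rw [hj, mul_zero]
  have hP : P = 0 :=
    Polynomial.eq_zero_of_degree_lt_of_eval_index_eq_zero Finset.univ hy.injOn hdeg heval
  intro i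
  have hi : P.eval (v i) = c i * (Lagrange.nodal (Finset.univ.erase i) v).eval (v i) := by
    simp only [P, Polynomial.eval_finsetSum, Polynomial.eval_mul, Polynomial.eval_C]
    refine Finset.sum_eq_single i (fun k _ hk => ?_) (by simp)
    rw [Lagrange.eval_nodal_at_node (by simp [hk.symm]), mul_zero]
  rw [hP, Polynomial.eval_zero, eq_comm] at hi
  refine (mul_eq_zero.1 hi).resolve_right (Lagrange.eval_nodal_not_at_node fun k hk h => ?_)
  exact Finset.ne_of_mem_erase hk (hx (neg_injective h)).symm

/-- Every `J × m` submatrix of a Cauchy matrix with `J ≤ m` has rank `J` (full row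
rank): the induced linear map `𝔽^m → 𝔽^J` is surjective. -/
theorem cauchy_submatrix_full_row_rank {𝔽 : Type*} [Field 𝔽] (n : ℕ) (hn : 0 < n)
    (x y : Fin n → 𝔽) (hx : Function.Injective x) (hy : Function.Injective y)
    (hxy : ∀ i j, x i + y j ≠ 0)
    (D : Matrix (Fin n) (Fin n) 𝔽) (hD : ∀ i j, D i j = (x i + y j)⁻¹) :
    ∀ (J m : ℕ), J ≤ m → m ≤ n → ∀ (row : Fin J → Fin n) (col : Fin m → Fin n),
      Function.Injective row → Function.Injective col →
        (D.submatrix row col).rank = J ∧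
          Function.Surjective (D.submatrix row col).mulVec := by
  intro J m hJm _ row col hrow hcol
  have hli : LinearIndependent 𝔽 (D.submatrix row col).row :=
    linearIndependent_row_of_cauchy (by simpa using hJm) (hx.comp hrow) (hy.comp hcol)
      (fun i j => hxy (row i) (col j)) _ (fun i j => hD (row i) (col j))
  have hrank : (D.submatrix row col).rank = J := by
    simpa using hli.rank_matrix
  have hrange : LinearMap.range (D.submatrix row col).mulVecLin = ⊤ :=
    Submodule.eq_top_of_finrank_eq (by rw [Module.finrank_fin_fun]; exact hrank)
  exact ⟨hrank, LinearMap.range_eq_top.1 hrange⟩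
end

section
/- Let 𝔽 be a finite field, F > Z ≥ 1 integers, and let D be the F×F Cauchy matrix associated with elements x_1,…,x_F, y_1,…,y_F ∈ 𝔽 (x_i pairwise distinct, y_j pairwise distinct, x_i + y_j ≠ 0 for all i, j). Write D = [D' | D''] where D' is the F×(F−Z) submatrix formed by the first F−Z columns and D'' is the F×Z submatrix formed by the last Z columns. Let (Ω, 𝓕, ℙ) be a probability space, W : Ω → 𝔽^{F−Z} an arbitrary random variable (the secret batch of files), and V : Ω → 𝔽^Z uniformly distributed on 𝔽^Z and independent of W (the key vector). Define the share vector A = D'·W + D''·V : Ω → 𝔽^F. Then for every subset 𝒜 ⊆ {1,…,F} with |𝒜| ≤ Z, the restriction of A to the coordinates in 𝒜 is uniformly distributed on 𝔽^{𝒜} and is independent of W; that is, any Z or fewer shares reveal no information about the secret: I(W; (A_f)_{f∈𝒜}) = 0. -/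
open MeasureTheory ProbabilityTheory

/-- The rows of a rectangular Cauchy matrix with at least as many columns as rows are linearly
independent. -/
theorem linearIndependent_cauchy_rows {K m n : Type*} [Field K] [Fintype m] [Fintype n]
    {x : m → K} {y : n → K} (hx : Function.Injective x) (hy : Function.Injective y)
    (hxy : ∀ i j, x i + y j ≠ 0) (hmn : Fintype.card m ≤ Fintype.card n) :
    LinearIndependent K (fun i j => (x i + y j)⁻¹) := by
  classical
  rw [Fintype.linearIndependent_iff]
  intro c hc i
  let p : Polynomial K := ∑ a, Polynomial.C (c a) *
    ∏ b ∈ Finset.univ.erase a, (Polynomial.C (x b) + Polynomial.X)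
  have hp : p = 0 := by
    refine Polynomial.eq_zero_of_natDegree_lt_card_of_eval_eq_zero p hy (fun j => ?_) ?_
    · have hj : ∑ a, c a * (x a + y j)⁻¹ = 0 := by simpa using congrFun hc j
      rw [Polynomial.eval_finsetSum, ← mul_zero (∏ b, (x b + y j)), ← hj, Finset.mul_sum]
      refine Finset.sum_congr rfl fun a ha => ?_
      rw [← Finset.mul_prod_erase _ _ ha]
      simp only [Polynomial.eval_mul, Polynomial.eval_C, Polynomial.eval_prod,
        Polynomial.eval_add, Polynomial.eval_X]
      field_simp [hxy a j]
    · have hm : 0 < Fintype.card m := Fintype.card_pos_iff.2 ⟨i⟩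
      have hdeg : p.natDegree ≤ Fintype.card m - 1 := by
        refine Polynomial.natDegree_sum_le_of_forall_le _ _ fun a _ => ?_
        refine (Polynomial.natDegree_C_mul_le _ _).trans
          ((Polynomial.natDegree_prod_le _ _).trans ?_)
        refine (Finset.sum_le_card_nsmul _ _ 1 fun b _ => ?_).trans ?_
        · compute_degree
        · simp [Finset.card_erase_of_mem]
      omega
  have h := congrArg (Polynomial.eval (-x i)) hp
  rw [Polynomial.eval_finsetSum, Finset.sum_eq_single i] at h
  · simp only [Polynomial.eval_mul, Polynomial.eval_C, Polynomial.eval_prod,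
      Polynomial.eval_add, Polynomial.eval_X, Polynomial.eval_zero] at h
    refine (mul_eq_zero.1 h).resolve_right (Finset.prod_ne_zero_iff.2 fun b hb => ?_)
    rw [← sub_eq_add_neg]
    exact sub_ne_zero.2 (hx.ne (Finset.ne_of_mem_erase hb))
  · intro a _ ha
    rw [Polynomial.eval_mul, Polynomial.eval_prod,
      Finset.prod_eq_zero (Finset.mem_erase.2 ⟨ha.symm, Finset.mem_univ i⟩) (by simp), mul_zero]
  · simp

theorem Matrix.mulVec_surjective_of_linearIndependent_rows {K m n : Type*} [Field K] [Fintype m]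
    [Fintype n] {M : Matrix m n K} (h : LinearIndependent K M.row) :
    Function.Surjective M.mulVec := by
  have hr : LinearMap.range M.mulVecLin = ⊤ :=
    Submodule.eq_top_of_finrank_eq (by simpa using! h.rank_matrix)
  exact LinearMap.range_eq_top.1 hr

/-- A surjective homomorphism of finite groups pushes the uniform measure forward to the uniform
measure. -/
theorem map_toMeasure_uniformOfFintype_of_surjective {G H : Type*} [AddGroup G] [AddGroup H]
    [Fintype G] [Fintype H] [MeasurableSpace G] [DiscreteMeasurableSpace G] [MeasurableSpace H]
    [DiscreteMeasurableSpace H] (f : G →+ H) (hf : Function.Surjective f) :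
    (PMF.uniformOfFintype G).toMeasure.map f = (PMF.uniformOfFintype H).toMeasure := by
  classical
  refine Measure.ext_of_singleton fun h => ?_
  have hfib (b : H) : Fintype.card (f ⁻¹' {b}) = Fintype.card (f ⁻¹' {h}) := by
    simpa [Fintype.card_subtype] using
      AddMonoidHom.card_fiber_eq_of_mem_range f (hf b) (hf h)
  have hcard : Fintype.card G = Fintype.card H * Fintype.card (f ⁻¹' {h}) := by
    rw [← Finset.card_univ, Finset.card_eq_sum_card_fiberwise (f := f) (t := Finset.univ)
      (by simp), ← smul_eq_mul, ← Finset.card_univ (α := H), ← Finset.sum_const]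
    refine Finset.sum_congr rfl fun b _ => ?_
    rw [← hfib b]
    simp [Fintype.card_subtype]
  have hpos : Fintype.card (f ⁻¹' {h}) ≠ 0 := by
    intro h0
    rw [h0, mul_zero] at hcard
    exact Fintype.card_ne_zero hcard
  rw [Measure.map_apply .of_discrete .of_discrete,
    PMF.toMeasure_uniformOfFintype_apply _ .of_discrete,
    PMF.toMeasure_apply_singleton _ _ .of_discrete, PMF.uniformOfFintype_apply, hcard, Nat.cast_mul]
  rw [← one_div, ← ENNReal.mul_div_mul_right 1 (Fintype.card H : ENNReal)
    (Nat.cast_ne_zero.2 hpos) (ENNReal.natCast_ne_top _), one_mul]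

/-- One-time pad: adding independent uniform noise `U` to a function of `X` gives a uniform
variable independent of `X`. -/
theorem uniform_and_indepFun_add {Ω α G : Type*} [MeasurableSpace Ω] {μ : Measure Ω}
    [IsProbabilityMeasure μ] [Countable α] [MeasurableSpace α] [DiscreteMeasurableSpace α]
    [AddGroup G] [Fintype G] [MeasurableSpace G] [DiscreteMeasurableSpace G]
    {X : Ω → α} {U : Ω → G} (hX : Measurable X) (hU : Measurable U)
    (hUunif : μ.map U = (PMF.uniformOfFintype G).toMeasure) (hXU : IndepFun X U μ) (f : α → G) :
    μ.map (fun ω => f (X ω) + U ω) = (PMF.uniformOfFintype G).toMeasure ∧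
      IndepFun X (fun ω => f (X ω) + U ω) μ := by
  have hS : Measurable (fun ω => f (X ω) + U ω) :=
    (Measurable.of_discrete (f := fun p : α × G => f p.1 + p.2)).comp (hX.prodMk hU)
  have hjoint : μ.map (fun ω => (X ω, f (X ω) + U ω)) =
      (μ.map X).prod (PMF.uniformOfFintype G).toMeasure := by
    refine Measure.ext_of_singleton fun ⟨a, g⟩ => ?_
    have hpre : (fun ω => (X ω, f (X ω) + U ω)) ⁻¹' {(a, g)} =
        X ⁻¹' {a} ∩ U ⁻¹' {-f a + g} := by
      ext ω
      simp only [Set.mem_preimage, Set.mem_singleton_iff, Prod.mk.injEq, Set.mem_inter_iff]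
      refine and_congr_right fun h => ?_
      rw [h, eq_neg_add_iff_add_eq]
    rw [Measure.map_apply (hX.prodMk hS) .of_discrete, hpre,
      hXU.measure_inter_preimage_eq_mul _ _ .of_discrete .of_discrete,
      ← Measure.map_apply hX .of_discrete, ← Measure.map_apply hU .of_discrete, hUunif,
      ← Set.singleton_prod_singleton, Measure.prod_prod,
      PMF.toMeasure_apply_singleton _ _ .of_discrete,
      PMF.toMeasure_apply_singleton _ _ .of_discrete, PMF.uniformOfFintype_apply,
      PMF.uniformOfFintype_apply]
  have := Measure.isProbabilityMeasure_map (μ := μ) hX.aemeasurable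
  have hmap : μ.map (fun ω => f (X ω) + U ω) = (PMF.uniformOfFintype G).toMeasure := by
    have h := congrArg Measure.snd hjoint
    rwa [Measure.snd_map_prodMk hX, Measure.snd_prod] at h
  refine ⟨hmap, ?_⟩
  rw [indepFun_iff_map_prod_eq_prod_map_map hX.aemeasurable hS.aemeasurable, hmap, hjoint]

/-- Secrecy of the `(Z,F)` non-perfect (ramp) secret sharing scheme of Theorem 2.
`D` is an `F × F` Cauchy matrix, `D'` its first `F − Z` columns, `D''` its last `Z`
columns; the secret `W` is an arbitrary random vector, the key `V` is uniform on `𝔽^Z`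
and independent of `W`, and the share vector is `A = D'·W + D''·V`. Then any `Z` or
fewer shares are uniformly distributed and independent of `W` (so they reveal no
information about the secret: `I(W; (A_f)_{f ∈ 𝒜}) = 0`). -/
theorem ramp_secret_sharing_secrecy
    {𝔽 : Type*} [Field 𝔽] [Fintype 𝔽] [MeasurableSpace 𝔽] [DiscreteMeasurableSpace 𝔽]
    (F Z : ℕ) (hZ : 1 ≤ Z) (hZF : Z < F)
    (x y : Fin F → 𝔽) (hx : Function.Injective x) (hy : Function.Injective y)
    (hxy : ∀ i j, x i + y j ≠ 0)
    (D : Matrix (Fin F) (Fin F) 𝔽) (hD : ∀ i j, D i j = (x i + y j)⁻¹)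
    (D' : Matrix (Fin F) (Fin (F - Z)) 𝔽) (D'' : Matrix (Fin F) (Fin Z) 𝔽)
    (hD' : ∀ i j, D' i j = D i (Fin.cast (Nat.sub_add_cancel hZF.le) (Fin.castAdd Z j)))
    (hD'' : ∀ i j, D'' i j =
      D i (Fin.cast (Nat.sub_add_cancel hZF.le) (Fin.natAdd (F - Z) j)))
    {Ω : Type*} [MeasurableSpace Ω] (μ : Measure Ω) [IsProbabilityMeasure μ]
    (W : Ω → Fin (F - Z) → 𝔽) (V : Ω → Fin Z → 𝔽)
    (hW : Measurable W) (hV : Measurable V)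
    (hVunif : μ.map V = (PMF.uniformOfFintype (Fin Z → 𝔽)).toMeasure)
    (hindep : IndepFun W V μ)
    (A : Ω → Fin F → 𝔽)
    (hA : ∀ ω, A ω = D'.mulVec (W ω) + D''.mulVec (V ω)) :
    ∀ 𝒜 : Finset (Fin F), 𝒜.card ≤ Z →
      μ.map (fun ω => fun a : 𝒜 => A ω a) =
          (PMF.uniformOfFintype (𝒜 → 𝔽)).toMeasure ∧
        IndepFun W (fun ω => fun a : 𝒜 => A ω a) μ := by
  intro 𝒜 h𝒜
  let M : Matrix 𝒜 (Fin Z) 𝔽 := D''.submatrix Subtype.val id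
  have hsurj : Function.Surjective M.mulVec := by
    apply Matrix.mulVec_surjective_of_linearIndependent_rows
    have h := linearIndependent_cauchy_rows (x := fun a : 𝒜 => x a)
      (y := fun j : Fin Z => y (Fin.cast (Nat.sub_add_cancel hZF.le) (Fin.natAdd (F - Z) j)))
      (hx.comp Subtype.val_injective)
      (hy.comp ((Fin.cast_injective _).comp (Fin.natAdd_injective _ _)))
      (fun _ _ => hxy _ _) (by simpa using h𝒜)
    convert h using 1
    ext a j
    simp [M, Matrix.row, hD'', hD]
  have hM : Measurable M.mulVec := .of_discrete
  have hA𝒜 : (fun ω => fun a : 𝒜 => A ω a) =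
      fun ω => (fun w => fun a : 𝒜 => D'.mulVec w a) (W ω) + M.mulVec (V ω) := by
    funext ω a
    rw [hA]
    rfl
  rw [hA𝒜]
  refine uniform_and_indepFun_add hW (hM.comp hV) ?_ (hindep.comp measurable_id hM)
    (fun w => fun a : 𝒜 => D'.mulVec w a)
  rw [← Measure.map_map hM hV, hVunif]
  exact map_toMeasure_uniformOfFintype_of_surjective M.mulVecLin.toAddMonoidHom hsurj
end
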